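/- For every c ∈ Σ = {0,1}^ℕ, setting k_i = 2^{2^i} and a_n = Σ_{i=0}^{2n} k_i, the frequency of the symbol 1 among the first a_n coordinates of x_c tends to zero: lim_{n→∞} (1/a_n) · #{0 ≤ j < a_n : (x_c)_j = 1} = 0. Consequently, the time averages of visits of the orbit of x_c under the shift map T to the cylinder [1] = {y ∈ Σ : y_0 = 1} converge to 0 along the sequence (a_n). -/

import Mathlib

open MeasureTheory Set Filter Topology

/-- The full two-sided alphabet shift space `Σ = {0,1}^ℕ` (with `1 = true`). -/
abbrev Sig : Type := ℕ → Bool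

/-- The shift map on `Σ`. -/
def shiftMap : Sig → Sig := fun x i => x (i + 1)

/-- Birkhoff average of visits of the orbit of `x` to `U` up to time `n`. -/
noncomputable def birkhoffAvg {X : Type*} (f : X → X) (U : Set X) (n : ℕ) (x : X) : ℝ :=
  (∑ k ∈ Finset.range n, U.indicator (fun _ => (1:ℝ)) (f^[k] x)) / n

/-- The σ-limit set of `x` under `f`. -/
def sigmaLim {X : Type*} [TopologicalSpace X] (f : X → X) (x : X) : Set X :=
  {z | ∀ U : Set X, IsOpen U → z ∈ U →
    0 < Filter.limsup (fun n => birkhoffAvg f U n x) Filter.atTop}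

/-- `k n = 2 ^ (2 ^ n)`. -/
def kseq (n : ℕ) : ℕ := 2 ^ 2 ^ n

/-- Length of the `n`-th binary word `w_n` in the length-then-value enumeration of all
finite nonempty binary words (`w_0 = 0`, `w_1 = 1`, `w_2 = 00`, ...): the `n`-th word
consists of the binary digits of `n + 2` with the leading `1` removed. -/
def wordLen (n : ℕ) : ℕ := Nat.log 2 (n + 2)

/-- The `p`-th letter (counted from the left, `0 ≤ p < wordLen n`) of the word `w_n`. -/
def wordBit (n p : ℕ) : Bool := (n + 2).testBit (wordLen n - 1 - p)

/-- Whether `w_n` is a prefix of `c`. -/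
def isPref (c : Sig) (n : ℕ) : Bool := decide (∀ p < wordLen n, c p = wordBit n p)

/-- Starting position of the `n`-th segment `A_n B_n^c w_n` in `x_c`;
`|A_n| = kseq (2n)` and `|B_n^c w_n| = kseq (2n+1)`. -/
def segStart : ℕ → ℕ
  | 0 => 0
  | n + 1 => segStart n + kseq (2 * n) + kseq (2 * n + 1)

/-- Index of the segment containing position `j`. -/
def segIdx (j : ℕ) : ℕ := Nat.findGreatest (fun m => segStart m ≤ j) j

/-- The point `x_c = A_0 B_0^c w_0 A_1 B_1^c w_1 A_2 B_2^c w_2 ⋯`, where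
`A_n = 0^{kseq (2n)}`, and `B_n^c` consists of `kseq (2n+1) - |w_n|` ones if `w_n` is a
prefix of `c` and of that many zeros otherwise. -/
def xc (c : Sig) : Sig := fun j =>
  let n := segIdx j
  let r := j - segStart n
  if r < kseq (2 * n) then false
  else if r - kseq (2 * n) < kseq (2 * n + 1) - wordLen n then isPref c n
  else wordBit n (r - kseq (2 * n) - (kseq (2 * n + 1) - wordLen n))

/-- `a_n = k_0 + k_1 + ⋯ + k_{2n}`. -/
def aseq (n : ℕ) : ℕ := ∑ i ∈ Finset.range (2 * n + 1), kseq i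

theorem two_le_kseq (n : ℕ) : 2 ≤ kseq n :=
  Nat.le_self_pow (by positivity) 2

theorem kseq_succ (n : ℕ) : kseq (n + 1) = kseq n ^ 2 := by
  simp only [kseq, pow_succ, pow_mul]

theorem lt_kseq_two_mul (n : ℕ) : n < kseq (2 * n) :=
  calc n < 2 ^ n := Nat.lt_two_pow_self
    _ ≤ kseq (2 * n) :=
      Nat.pow_le_pow_right two_pos
        (Nat.lt_two_pow_self.le.trans (Nat.pow_le_pow_right two_pos (by omega)))

theorem strictMono_segStart : StrictMono segStart :=
  strictMono_nat_of_lt_succ fun n => by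
    have := two_le_kseq (2 * n)
    simp only [segStart]
    omega

theorem aseq_eq (n : ℕ) : aseq n = segStart n + kseq (2 * n) := by
  have h : ∀ m, ∑ i ∈ Finset.range (2 * m), kseq i = segStart m := by
    intro m
    induction m with
    | zero => rfl
    | succ m ih => rw [Nat.mul_succ, Finset.sum_range_succ, Finset.sum_range_succ, ih, segStart]
  rw [aseq, Finset.sum_range_succ, h]

theorem segStart_succ_le (n : ℕ) (h : segStart n ≤ kseq (2 * n)) :
    segStart (n + 1) ≤ kseq (2 * n) ^ 3 := by
  have h2 := two_le_kseq (2 * n)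
  rw [segStart, kseq_succ]
  nlinarith [Nat.mul_le_mul h2 h2, Nat.mul_le_mul_right (kseq (2 * n)) h2,
    Nat.mul_le_mul_right (kseq (2 * n) ^ 2) h2]

theorem kseq_two_mul_succ (n : ℕ) : kseq (2 * (n + 1)) = kseq (2 * n) ^ 4 := by
  rw [Nat.mul_succ, kseq_succ, kseq_succ, ← pow_mul]

theorem segStart_le_kseq (n : ℕ) : segStart n ≤ kseq (2 * n) := by
  induction n with
  | zero => simp [segStart]
  | succ n ih =>
    rw [kseq_two_mul_succ]
    exact (segStart_succ_le n ih).trans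
      (Nat.pow_le_pow_right (by have := two_le_kseq (2 * n); omega) (by norm_num))

theorem segStart_mul_le_kseq (n : ℕ) : segStart n * n ≤ kseq (2 * n) := by
  cases n with
  | zero => simp
  | succ n =>
    rw [kseq_two_mul_succ, pow_succ]
    exact Nat.mul_le_mul (segStart_succ_le n (segStart_le_kseq n)) (lt_kseq_two_mul n)

theorem segIdx_eq {n j : ℕ} (h₁ : segStart n ≤ j) (h₂ : j < segStart (n + 1)) :
    segIdx j = n := by
  rw [segIdx, Nat.findGreatest_eq_iff]
  refine ⟨(strictMono_segStart.le_apply).trans h₁, fun _ => h₁, fun m hm _ hj => ?_⟩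
  exact absurd (strictMono_segStart.monotone hm) (by simp only [Nat.succ_eq_add_one]; omega)

/-- The points `x_c` vanish on the blocks `A_n`. -/
theorem xc_eq_false (c : Sig) {n j : ℕ} (h₁ : segStart n ≤ j)
    (h₂ : j < segStart n + kseq (2 * n)) : xc c j = false := by
  have h : segIdx j = n := segIdx_eq h₁ (by rw [segStart]; omega)
  simp only [xc, h]
  exact if_pos (by omega)

theorem card_xc_true_le (c : Sig) (n : ℕ) :
    ((Finset.range (aseq n)).filter (fun j => xc c j = true)).card ≤ segStart n := by
  conv_rhs => rw [← Finset.card_range (segStart n)]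
  refine Finset.card_le_card fun j hj => ?_
  rw [Finset.mem_filter, Finset.mem_range, aseq_eq] at hj
  by_contra hn
  rw [Finset.mem_range, not_lt] at hn
  simp [xc_eq_false c hn hj.1] at hj

theorem shiftMap_iterate (k : ℕ) (x : Sig) (i : ℕ) : shiftMap^[k] x i = x (i + k) := by
  induction k generalizing i with
  | zero => rfl
  | succ k ih =>
    rw [Function.iterate_succ_apply', shiftMap, ih]
    congr 1
    omega

theorem birkhoffAvg_shiftMap_cylinder (n : ℕ) (x : Sig) :
    birkhoffAvg shiftMap {y : Sig | y 0 = true} n x =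
      (((Finset.range n).filter (fun j => x j = true)).card : ℝ) / n := by
  simp [birkhoffAvg, Set.indicator_apply, shiftMap_iterate]

theorem tendsto_card_xc_true_div (c : Sig) :
    Tendsto
      (fun n => (((Finset.range (aseq n)).filter (fun j => xc c j = true)).card : ℝ)
        / (aseq n)) atTop (nhds 0) := by
  refine tendsto_of_tendsto_of_tendsto_of_le_of_le' tendsto_const_nhds
    (tendsto_const_div_atTop_nhds_zero_nat 1)
    (Eventually.of_forall fun n => by positivity) ?_
  filter_upwards [eventually_gt_atTop 0] with n hn
  have ha : 0 < aseq n := by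
    rw [aseq_eq]
    have := two_le_kseq (2 * n)
    omega
  rw [div_le_div_iff₀ (by exact_mod_cast ha) (by exact_mod_cast hn), one_mul]
  norm_cast
  calc _ ≤ segStart n * n := Nat.mul_le_mul_right n (card_xc_true_le c n)
    _ ≤ kseq (2 * n) := segStart_mul_le_kseq n
    _ ≤ aseq n := by rw [aseq_eq]; omega

/-- the frequency of the symbol `1` among the first `a_n` coordinates of
`x_c` tends to zero; consequently the time averages of visits of the orbit of `x_c` to
the cylinder `[1]` converge to `0` along `(a_n)`. -/
theorem stmt14 (c : Sig) :
    Tendsto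
      (fun n => (((Finset.range (aseq n)).filter (fun j => xc c j = true)).card : ℝ)
        / (aseq n)) atTop (nhds 0) ∧
    Tendsto
      (fun n => birkhoffAvg shiftMap {y : Sig | y 0 = true} (aseq n) (xc c))
      atTop (nhds 0) := by
  simp only [birkhoffAvg_shiftMap_cylinder]
  exact ⟨tendsto_card_xc_true_div c, tendsto_card_xc_true_div c⟩
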